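/- arXiv:1109.3771 — 2 statements merged into one kernel-verified Lean document; each statement's English description precedes it below -/
import Mathlib

section
/- Let R be a ring with Jacobson radical J and let 0 → K →f→ M →g→ N → 0 be a short exact sequence of finitely generated R-modules. Suppose there is a commutative diagram with exact rows 0 → P →ι→ L →π→ Q → 0 over 0 → K → M → N → 0, whose vertical maps p : P → K, l : L → M, q : Q → N are projective covers (so p, l, q are surjective with kernels contained in J·P, J·L, J·Q respectively, and f ∘ p = l ∘ ι, q ∘ π = g ∘ l). Then f(J·K) = f(K) ∩ J·M. -/
/-- `jSMul I K` is the submodule `I·K` generated by the products `r • k`,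
`r ∈ I`, `k ∈ K`. -/
def jSMul {R : Type} [Ring R] {M : Type} [AddCommGroup M] [Module R M]
    (I : Ideal R) (K : Submodule R M) : Submodule R M :=
  Submodule.span R {x : M | ∃ r ∈ I, ∃ k ∈ K, x = r • k}

/-- `jPowSMul I n K` is the submodule `Iⁿ·K`. -/
def jPowSMul {R : Type} [Ring R] {M : Type} [AddCommGroup M] [Module R M]
    (I : Ideal R) : ℕ → Submodule R M → Submodule R M
  | 0, K => K
  | n + 1, K => jSMul I (jPowSMul I n K)

/-- The Jacobson radical of a ring. -/
abbrev jacobsonRad (R : Type) [Ring R] : Ideal R := Ideal.jacobson (⊥ : Ideal R)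

/-- A minimal projective resolution `⋯ → P₁ → P₀ → X → 0`. -/
structure MinProjRes (R : Type) [Ring R] (J : Ideal R)
    (X : Type) [AddCommGroup X] [Module R X] where
  obj : ℕ → Type
  [addcomm : ∀ n, AddCommGroup (obj n)]
  [mod : ∀ n, Module R (obj n)]
  proj : ∀ n, Module.Projective R (obj n)
  fin : ∀ n, Module.Finite R (obj n)
  d : ∀ n, obj (n + 1) →ₗ[R] obj n
  aug : obj 0 →ₗ[R] X
  aug_surj : Function.Surjective aug
  exact0 : LinearMap.range (d 0) = LinearMap.ker aug
  exact : ∀ n, LinearMap.range (d (n + 1)) = LinearMap.ker (d n)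
  minimal0 : LinearMap.ker aug ≤ jSMul J ⊤
  minimal : ∀ n, LinearMap.ker (d n) ≤ jSMul J ⊤

attribute [instance] MinProjRes.addcomm MinProjRes.mod

/-- The syzygies of a minimal projective resolution: `P.syz n ⊆ Pₙ`
is the `(n+1)`-st syzygy `Ω^{n+1}(X) = ker dₙ`. -/
def MinProjRes.syz {R : Type} [Ring R] {J : Ideal R}
    {X : Type} [AddCommGroup X] [Module R X]
    (P : MinProjRes R J X) : ∀ n, Submodule R (P.obj n)
  | 0 => LinearMap.ker P.aug
  | n + 1 => LinearMap.ker (P.d n)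

/-- A projective cover of a finitely generated module. -/
structure ProjCover (R : Type) [Ring R] (J : Ideal R)
    (X : Type) [AddCommGroup X] [Module R X] where
  P : Type
  [addcomm : AddCommGroup P]
  [mod : Module R P]
  p : P →ₗ[R] X
  proj : Module.Projective R P
  fin : Module.Finite R P
  surj : Function.Surjective p
  ker_le : LinearMap.ker p ≤ jSMul J ⊤

attribute [instance] ProjCover.addcomm ProjCover.mod

/-- `R` is semiperfect: every finitely generated module has a projective cover. -/
def Semiperfect (R : Type) [Ring R] : Prop :=
  ∀ (X : Type) [AddCommGroup X] [Module R X], Module.Finite R X →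
    Nonempty (ProjCover R (jacobsonRad R) X)

/-- The minimal Horseshoe Lemma holds for the short exact sequence
`0 → K →f→ M →g→ N → 0`. -/
def MinimalHorseshoe {R : Type} [Ring R] (J : Ideal R)
    {K M N : Type} [AddCommGroup K] [Module R K] [AddCommGroup M] [Module R M]
    [AddCommGroup N] [Module R N] (f : K →ₗ[R] M) (g : M →ₗ[R] N) : Prop :=
  ∃ (P : MinProjRes R J K) (L : MinProjRes R J M) (Q : MinProjRes R J N)
    (φ : ∀ n, P.obj n →ₗ[R] L.obj n) (ψ : ∀ n, L.obj n →ₗ[R] Q.obj n),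
    L.aug ∘ₗ φ 0 = f ∘ₗ P.aug ∧
    Q.aug ∘ₗ ψ 0 = g ∘ₗ L.aug ∧
    (∀ n, L.d n ∘ₗ φ (n + 1) = φ n ∘ₗ P.d n) ∧
    (∀ n, Q.d n ∘ₗ ψ (n + 1) = ψ n ∘ₗ L.d n) ∧
    (∀ n, Function.Injective (φ n)) ∧
    (∀ n, Function.Surjective (ψ n)) ∧
    (∀ n, LinearMap.ker (ψ n) = LinearMap.range (φ n))

/-- `X` is a quasi-`δ`-Koszul module. -/
def IsQuasiDeltaKoszul {R : Type} [Ring R] (J : Ideal R) (δ : ℕ → ℕ)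
    (X : Type) [AddCommGroup X] [Module R X] : Prop :=
  ∃ P : MinProjRes R J X, ∀ n,
    P.syz n ≤ jPowSMul J (δ (n + 1) - δ n) ⊤ ∧
    jSMul J (P.syz n) = P.syz n ⊓ jPowSMul J (δ (n + 1) - δ n + 1) ⊤

/-- `X` is a quasi-Koszul module. -/
def IsQuasiKoszul {R : Type} [Ring R] (J : Ideal R)
    (X : Type) [AddCommGroup X] [Module R X] : Prop :=
  ∃ P : MinProjRes R J X, ∀ n,
    jSMul J (P.syz n) = P.syz n ⊓ jPowSMul J 2 ⊤

/-- Linear maps commute with `I · _`. -/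
theorem map_jSMul {R : Type} [Ring R] {M N : Type} [AddCommGroup M] [Module R M]
    [AddCommGroup N] [Module R N] (I : Ideal R) (f : M →ₗ[R] N) (K : Submodule R M) :
    (jSMul I K).map f = jSMul I (K.map f) := by
  rw [jSMul, jSMul, Submodule.map_span]
  congr 1
  ext y
  constructor
  · rintro ⟨_, ⟨r, hr, k, hk, rfl⟩, rfl⟩
    exact ⟨r, hr, f k, Submodule.mem_map_of_mem hk, map_smul f r k⟩
  · rintro ⟨r, hr, _, ⟨k, hk, rfl⟩, rfl⟩
    exact ⟨r • k, ⟨r, hr, k, hk, rfl⟩, map_smul f r k⟩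

theorem jSMul_mono {R : Type} [Ring R] {M : Type} [AddCommGroup M] [Module R M]
    (I : Ideal R) {K K' : Submodule R M} (h : K ≤ K') : jSMul I K ≤ jSMul I K' := by
  apply Submodule.span_mono
  rintro _ ⟨r, hr, k, hk, rfl⟩
  exact ⟨r, hr, k, h hk, rfl⟩

theorem map_jSMul_top_le {R : Type} [Ring R] {M N : Type} [AddCommGroup M] [Module R M]
    [AddCommGroup N] [Module R N] (I : Ideal R) (f : M →ₗ[R] N) :
    (jSMul I ⊤).map f ≤ jSMul I ⊤ :=
  (map_jSMul I f ⊤).trans_le (jSMul_mono I le_top)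

/-- An injection onto the kernel of a surjection to a projective module has a retraction. -/
theorem exists_retraction_of_projective {R : Type} [Ring R] {P L Q : Type}
    [AddCommGroup P] [Module R P] [AddCommGroup L] [Module R L] [AddCommGroup Q] [Module R Q]
    [Module.Projective R Q] (ι : P →ₗ[R] L) (π : L →ₗ[R] Q)
    (hι : Function.Injective ι) (hπ : Function.Surjective π)
    (h : LinearMap.range ι = LinearMap.ker π) : ∃ r : L →ₗ[R] P, r ∘ₗ ι = LinearMap.id :=
  (((LinearMap.exact_iff.mpr h.symm).split_tfae'.out 0 1 :
    (Function.Injective ι ∧ ∃ s, π ∘ₗ s = LinearMap.id) ↔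
      (Function.Surjective π ∧ ∃ r, r ∘ₗ ι = LinearMap.id)).mp
    ⟨hι, Module.projective_lifting_property π LinearMap.id hπ⟩).2

/-- a commutative diagram of projective covers over a short exact
sequence forces `f(J·K) = f(K) ∩ J·M`. -/
theorem jsmul_eq_of_cover_diagram {R : Type} [Ring R] (J : Ideal R)
    (hJ : J = jacobsonRad R)
    {K M N : Type} [AddCommGroup K] [Module R K] [AddCommGroup M] [Module R M]
    [AddCommGroup N] [Module R N]
    [Module.Finite R K] [Module.Finite R M] [Module.Finite R N]
    (f : K →ₗ[R] M) (g : M →ₗ[R] N)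
    (hf : Function.Injective f) (hg : Function.Surjective g)
    (hfg : LinearMap.range f = LinearMap.ker g)
    {P L Q : Type} [AddCommGroup P] [Module R P] [AddCommGroup L] [Module R L]
    [AddCommGroup Q] [Module R Q]
    (hPproj : Module.Projective R P) (hPfin : Module.Finite R P)
    (hLproj : Module.Projective R L) (hLfin : Module.Finite R L)
    (hQproj : Module.Projective R Q) (hQfin : Module.Finite R Q)
    (ι : P →ₗ[R] L) (π : L →ₗ[R] Q)
    (hι : Function.Injective ι) (hπ : Function.Surjective π)
    (hιπ : LinearMap.range ι = LinearMap.ker π)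
    (p : P →ₗ[R] K) (hp : Function.Surjective p)
    (hpker : LinearMap.ker p ≤ jSMul J (⊤ : Submodule R P))
    (l : L →ₗ[R] M) (hl : Function.Surjective l)
    (hlker : LinearMap.ker l ≤ jSMul J (⊤ : Submodule R L))
    (q : Q →ₗ[R] N) (hq : Function.Surjective q)
    (hqker : LinearMap.ker q ≤ jSMul J (⊤ : Submodule R Q))
    (hcomm₁ : f ∘ₗ p = l ∘ₗ ι) (hcomm₂ : q ∘ₗ π = g ∘ₗ l) :
    Submodule.map f (jSMul J (⊤ : Submodule R K)) =
      LinearMap.range f ⊓ jSMul J (⊤ : Submodule R M) := by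
  obtain ⟨r, hr⟩ := exists_retraction_of_projective ι π hι hπ hιπ
  apply le_antisymm
  · exact le_inf LinearMap.map_le_range (map_jSMul_top_le J f)
  · rintro _ ⟨⟨k, rfl⟩, hk⟩
    refine Submodule.mem_map_of_mem ?_
    obtain ⟨a, rfl⟩ := hp k
    rw [← LinearMap.range_eq_top.mpr hl, LinearMap.range_eq_map, ← map_jSMul] at hk
    obtain ⟨y, hy, hya⟩ := hk
    have hla : f (p a) = l (ι a) := LinearMap.congr_fun hcomm₁ a
    have hsub : ι a - y ∈ jSMul J (⊤ : Submodule R L) :=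
      hlker (by rw [LinearMap.mem_ker, map_sub, hya, hla, sub_self])
    have hιa : ι a ∈ jSMul J (⊤ : Submodule R L) := by
      simpa using add_mem hsub hy
    have hra : r (ι a) = a := LinearMap.congr_fun hr a
    have ha : a ∈ jSMul J (⊤ : Submodule R P) :=
      hra ▸ map_jSMul_top_le J r (Submodule.mem_map_of_mem hιa)
    exact map_jSMul_top_le J p (Submodule.mem_map_of_mem ha)
end

section
/- Let R be an augmented Noetherian semiperfect algebra with Jacobson radical J and let ξ : 0 → K → M → N → 0 be a short exact sequence of finitely generated R-modules in which K, M and N are all quasi-Koszul modules. Then J·K = K ∩ J·M (identifying K with its image in M) if and only if the minimal Horseshoe Lemma holds for ξ. -/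
section JSMul

variable {R : Type} [Ring R] {J : Ideal R}
  {M N : Type} [AddCommGroup M] [Module R M] [AddCommGroup N] [Module R N]

lemma jSMul_mono_s6 {A B : Submodule R M} (h : A ≤ B) : jSMul J A ≤ jSMul J B :=
  Submodule.span_mono fun _ ⟨r, hr, a, ha, hx⟩ => ⟨r, hr, a, h ha, hx⟩

lemma map_jSMul_s6 (f : M →ₗ[R] N) (A : Submodule R M) :
    Submodule.map f (jSMul J A) = jSMul J (Submodule.map f A) := by
  unfold jSMul
  rw [Submodule.map_span]
  congr 1
  ext y
  constructor
  · rintro ⟨_, ⟨r, hr, a, ha, rfl⟩, rfl⟩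
    exact ⟨r, hr, f a, ⟨a, ha, rfl⟩, map_smul f r a⟩
  · rintro ⟨r, hr, _, ⟨a, ha, rfl⟩, rfl⟩
    exact ⟨r • a, ⟨r, hr, a, ha, rfl⟩, map_smul f r a⟩

lemma map_mem_jSMul (f : M →ₗ[R] N) {A : Submodule R M} {B : Submodule R N}
    (h : ∀ a ∈ A, f a ∈ B) {x : M} (hx : x ∈ jSMul J A) : f x ∈ jSMul J B := by
  have h₁ : f x ∈ Submodule.map f (jSMul J A) := ⟨x, hx, rfl⟩
  rw [map_jSMul_s6] at h₁
  exact jSMul_mono_s6 (Submodule.map_le_iff_le_comap.2 h) h₁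

lemma map_mem_jSMul_top (f : M →ₗ[R] N) {x : M} (hx : x ∈ jSMul J (⊤ : Submodule R M)) :
    f x ∈ jSMul J (⊤ : Submodule R N) :=
  map_mem_jSMul f (fun _ _ => Submodule.mem_top) hx

lemma prod_mk_mem_jSMul_top {x : M} {y : N} (hx : x ∈ jSMul J (⊤ : Submodule R M))
    (hy : y ∈ jSMul J (⊤ : Submodule R N)) :
    (x, y) ∈ jSMul J (⊤ : Submodule R (M × N)) := by
  have h := add_mem (map_mem_jSMul_top (LinearMap.inl R M N) hx)
    (map_mem_jSMul_top (LinearMap.inr R M N) hy)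
  simpa using h

/-- A preimage of a point of `J·f(A)` can be corrected into `J·A` modulo the kernel. -/
lemma mem_jSMul_top_of_map_mem (a : M →ₗ[R] N) (hker : LinearMap.ker a ≤ jSMul J ⊤)
    {x : M} (hx : a x ∈ jSMul J (LinearMap.range a)) : x ∈ jSMul J (⊤ : Submodule R M) := by
  rw [LinearMap.range_eq_map, ← map_jSMul_s6] at hx
  obtain ⟨y, hy, hxy⟩ := hx
  have h : x - y ∈ jSMul J (⊤ : Submodule R M) := hker (by simp [hxy])
  simpa using add_mem h hy

/-- The kernel of `(p, q) ↦ a p + s q` over elements `q ∈ J·Q`. -/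
lemma mem_jSMul_top_of_add_eq_zero {Q : Type} [AddCommGroup Q] [Module R Q]
    (a : M →ₗ[R] N) (s : Q →ₗ[R] N) (T : Submodule R N)
    (hT : LinearMap.range a ⊓ jSMul J T ≤ jSMul J (LinearMap.range a))
    (hker : LinearMap.ker a ≤ jSMul J ⊤) (hs : ∀ q, s q ∈ T)
    {p : M} {q : Q} (hq : q ∈ jSMul J (⊤ : Submodule R Q)) (h : a p + s q = 0) :
    p ∈ jSMul J (⊤ : Submodule R M) := by
  refine mem_jSMul_top_of_map_mem a hker (hT ⟨⟨p, rfl⟩, ?_⟩)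
  rw [eq_neg_of_add_eq_zero_left h]
  exact neg_mem (map_mem_jSMul s (fun q _ => hs q) hq)

end JSMul

lemma exists_comp_eq_of_range_le {R : Type} [Ring R] {P Q X : Type}
    [AddCommGroup P] [Module R P] [AddCommGroup Q] [Module R Q] [AddCommGroup X] [Module R X]
    [Module.Projective R Q] (a : P →ₗ[R] X) (b : Q →ₗ[R] X) (h : ∀ q, b q ∈ LinearMap.range a) :
    ∃ t : Q →ₗ[R] P, ∀ q, a (t q) = b q := by
  obtain ⟨t, ht⟩ := Module.projective_lifting_property a.rangeRestrict
    (b.codRestrict (LinearMap.range a) h) a.surjective_rangeRestrict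
  exact ⟨t, fun q => congrArg Subtype.val (LinearMap.congr_fun ht q)⟩

section Horseshoe

variable {R : Type} [Ring R] {J : Ideal R}
  {K M N : Type} [AddCommGroup K] [Module R K] [AddCommGroup M] [Module R M]
  [AddCommGroup N] [Module R N] {f : K →ₗ[R] M} {g : M →ₗ[R] N}

lemma MinProjRes.aug_d {X : Type} [AddCommGroup X] [Module R X] (P : MinProjRes R J X)
    (x : P.obj 1) : P.aug (P.d 0 x) = 0 := by
  have h : P.d 0 x ∈ LinearMap.range (P.d 0) := ⟨x, rfl⟩
  rwa [P.exact0] at h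

lemma MinProjRes.d_d {X : Type} [AddCommGroup X] [Module R X] (P : MinProjRes R J X)
    (n : ℕ) (x : P.obj (n + 2)) : P.d n (P.d (n + 1) x) = 0 := by
  have h : P.d (n + 1) x ∈ LinearMap.range (P.d (n + 1)) := ⟨x, rfl⟩
  rwa [P.exact n] at h

lemma MinProjRes.range_d {X : Type} [AddCommGroup X] [Module R X] (P : MinProjRes R J X)
    (n : ℕ) : LinearMap.range (P.d n) = P.syz n := by
  cases n with
  | zero => exact P.exact0
  | succ n => exact P.exact n

/-- The twisting maps of the horseshoe construction. -/
lemma exists_horseshoe_twist (hf : Function.Injective f) (hg : Function.Surjective g)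
    (hfg : LinearMap.range f = LinearMap.ker g) (P : MinProjRes R J K) (Q : MinProjRes R J N) :
    ∃ (h : Q.obj 0 →ₗ[R] M) (s : ∀ n, Q.obj (n + 1) →ₗ[R] P.obj n),
      (∀ q, g (h q) = Q.aug q) ∧
      (∀ q, f (P.aug (s 0 q)) + h (Q.d 0 q) = 0) ∧
      ∀ n q, P.d n (s (n + 1) q) + s n (Q.d (n + 1) q) = 0 := by
  have := Q.proj
  obtain ⟨h, hh⟩ := exists_comp_eq_of_range_le g Q.aug (fun q => hg _)
  obtain ⟨s₀, hs₀⟩ := exists_comp_eq_of_range_le (f ∘ₗ P.aug) (-(h ∘ₗ Q.d 0)) (fun q => by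
    have hq : h (Q.d 0 q) ∈ LinearMap.range f := by
      rw [hfg, LinearMap.mem_ker, hh, Q.aug_d]
    obtain ⟨x, hx⟩ := hq
    obtain ⟨p, hp⟩ := P.aug_surj x
    exact ⟨-p, by simp [hp, hx]⟩)
  obtain ⟨s₁, hs₁⟩ := exists_comp_eq_of_range_le (P.d 0) (-(s₀ ∘ₗ Q.d 1)) (fun q => by
    rw [P.exact0, LinearMap.mem_ker]
    apply hf
    have := hs₀ (Q.d 1 q)
    simp only [LinearMap.comp_apply, LinearMap.neg_apply, Q.d_d, map_zero, neg_zero] at this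
    simp [this])
  let S : ℕ → Type := fun n =>
    {p : (Q.obj (n + 1) →ₗ[R] P.obj n) × (Q.obj (n + 2) →ₗ[R] P.obj (n + 1)) //
      ∀ q, P.d n (p.2 q) + p.1 (Q.d (n + 1) q) = 0}
  have step : ∀ n (p : S n), ∃ t : Q.obj (n + 3) →ₗ[R] P.obj (n + 2),
      ∀ q, P.d (n + 1) (t q) + p.1.2 (Q.d (n + 2) q) = 0 := fun n p => by
    obtain ⟨t, ht⟩ := exists_comp_eq_of_range_le (P.d (n + 1)) (-(p.1.2 ∘ₗ Q.d (n + 2)))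
      (fun q => by
        rw [P.exact n, LinearMap.mem_ker]
        have := p.2 (Q.d (n + 2) q)
        rw [Q.d_d, map_zero, add_zero] at this
        simp [this])
    exact ⟨t, fun q => by simp [ht]⟩
  choose t ht using step
  let st : ∀ n, S n := fun n => Nat.rec (motive := S) ⟨(s₀, s₁), fun q => by simp [hs₁]⟩
    (fun n p => ⟨(p.1.2, t n p), ht n p⟩) n
  refine ⟨h, fun n => (st n).1.1, hh, fun q => ?_, fun n q => (st n).2 q⟩
  have := hs₀ q
  simp only [LinearMap.comp_apply, LinearMap.neg_apply] at this
  exact add_eq_zero_iff_eq_neg.2 this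

/-- The condition `J·K = K ∩ J·M` gives the minimal Horseshoe Lemma when `K` is quasi-Koszul. -/
lemma minimalHorseshoe_of_isQuasiKoszul
    (hf : Function.Injective f) (hg : Function.Surjective g)
    (hfg : LinearMap.range f = LinearMap.ker g)
    (hK : IsQuasiKoszul J K) (Q : MinProjRes R J N)
    (hJK : LinearMap.range f ⊓ jSMul J (⊤ : Submodule R M) ≤ Submodule.map f (jSMul J ⊤)) :
    MinimalHorseshoe J f g := by
  obtain ⟨P, hP⟩ := hK
  obtain ⟨h, s, hh, hs₀, hs⟩ := exists_horseshoe_twist hf hg hfg P Q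
  have hgf : ∀ x, g (f x) = 0 := fun x => by
    have hx : f x ∈ LinearMap.range f := ⟨x, rfl⟩
    rwa [hfg] at hx
  have hfa : LinearMap.range (f ∘ₗ P.aug) = LinearMap.range f := by
    rw [LinearMap.range_comp, LinearMap.range_eq_top.2 P.aug_surj, LinearMap.range_eq_map]
  let A : P.obj 0 × Q.obj 0 →ₗ[R] M := (f ∘ₗ P.aug).coprod h
  let D : ∀ n, P.obj (n + 1) × Q.obj (n + 1) →ₗ[R] P.obj n × Q.obj n := fun n =>
    ((P.d n).coprod (s n)).prod (Q.d n ∘ₗ LinearMap.snd R _ _)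
  have hA : ∀ p q, A (p, q) = f (P.aug p) + h q := fun p q => rfl
  have hD : ∀ n p q, D n (p, q) = (P.d n p + s n q, Q.d n q) := fun n p q => rfl
  have hA0 : ∀ x, A (D 0 x) = 0 := fun ⟨p, q⟩ => by
    rw [hD, hA, map_add, P.aug_d, zero_add, hs₀]
  have hDD : ∀ n x, D n (D (n + 1) x) = 0 := fun n ⟨p, q⟩ => by
    rw [hD, hD, map_add, P.d_d, zero_add, hs, Q.d_d]; rfl
  have hAmin : LinearMap.ker A ≤ jSMul J ⊤ := by
    rintro ⟨p, q⟩ hpq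
    rw [LinearMap.mem_ker, hA] at hpq
    have hq : q ∈ jSMul J (⊤ : Submodule R (Q.obj 0)) := Q.minimal0 (by
      have := congrArg g hpq
      rwa [map_add, hgf, hh, zero_add, map_zero] at this)
    refine prod_mk_mem_jSMul_top
      (mem_jSMul_top_of_add_eq_zero (f ∘ₗ P.aug) h ⊤ ?_ ?_ (fun _ => trivial) hq hpq) hq
    · rw [hfa]
      refine hJK.trans ?_
      rw [map_jSMul_s6, LinearMap.range_eq_map]
    · rw [LinearMap.ker_comp_of_ker_eq_bot _ (LinearMap.ker_eq_bot.2 hf)]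
      exact P.minimal0
  have key : ∀ n, (∀ q, s n q ∈ jSMul J (⊤ : Submodule R (P.obj n))) →
      LinearMap.ker (D n) ≤ jSMul J ⊤ := by
    rintro n hn ⟨p, q⟩ hpq
    rw [LinearMap.mem_ker, hD, Prod.mk_eq_zero] at hpq
    have hq := Q.minimal n hpq.2
    refine prod_mk_mem_jSMul_top
      (mem_jSMul_top_of_add_eq_zero (P.d n) (s n) _ ?_ (P.minimal n) hn hq hpq.1) hq
    rw [P.range_d]
    exact (hP n).ge
  have hDmin : ∀ n, LinearMap.ker (D n) ≤ jSMul J ⊤ := fun n => by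
    induction n with
    | zero =>
      refine key 0 fun q => ?_
      simpa [hD] using map_mem_jSMul_top (LinearMap.fst R _ _) (hAmin (hA0 (0, q)))
    | succ n ih =>
      refine key (n + 1) fun q => ?_
      simpa [hD] using map_mem_jSMul_top (LinearMap.fst R _ _) (ih (hDD n (0, q)))
  let L : MinProjRes R J M :=
    { obj := fun n => P.obj n × Q.obj n
      proj := fun n => by
        have := P.proj n
        have := Q.proj n
        infer_instance
      fin := fun n => by
        have := P.fin n
        have := Q.fin n
        infer_instance
      d := D
      aug := A
      aug_surj := fun m => by
        obtain ⟨q, hq⟩ := Q.aug_surj (g m)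
        have hm : m - h q ∈ LinearMap.range f := by
          rw [hfg, LinearMap.mem_ker, map_sub, hh, hq, sub_self]
        obtain ⟨x, hx⟩ := hm
        obtain ⟨p, rfl⟩ := P.aug_surj x
        exact ⟨(p, q), by rw [hA, hx, sub_add_cancel]⟩
      exact0 := by
        refine le_antisymm (by rintro _ ⟨x, rfl⟩; exact hA0 x) ?_
        rintro ⟨p, q⟩ hpq
        rw [LinearMap.mem_ker, hA] at hpq
        have hq : q ∈ LinearMap.ker Q.aug := by
          have := congrArg g hpq
          rwa [map_add, hgf, hh, zero_add, map_zero] at this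
        rw [← Q.exact0] at hq
        obtain ⟨q', rfl⟩ := hq
        have hp : p - s 0 q' ∈ LinearMap.ker P.aug := by
          rw [LinearMap.mem_ker, map_sub, sub_eq_zero]
          exact hf (add_right_cancel (hpq.trans (hs₀ q').symm))
        rw [← P.exact0] at hp
        obtain ⟨p', hp'⟩ := hp
        exact ⟨(p', q'), by rw [hD, hp', sub_add_cancel]⟩
      exact := fun n => by
        refine le_antisymm (by rintro _ ⟨x, rfl⟩; exact hDD n x) ?_
        rintro ⟨p, q⟩ hpq
        rw [LinearMap.mem_ker, hD, Prod.mk_eq_zero] at hpq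
        obtain ⟨hpq, hq⟩ := hpq
        rw [← LinearMap.mem_ker, ← Q.exact n] at hq
        obtain ⟨q', rfl⟩ := hq
        have hp : p - s (n + 1) q' ∈ LinearMap.ker (P.d n) := by
          rw [LinearMap.mem_ker, map_sub, sub_eq_zero]
          exact add_right_cancel (hpq.trans (hs n q').symm)
        rw [← P.exact n] at hp
        obtain ⟨p', hp'⟩ := hp
        exact ⟨(p', q'), by rw [hD, hp', sub_add_cancel]⟩
      minimal0 := hAmin
      minimal := hDmin }
  refine ⟨P, L, Q, fun n => LinearMap.inl R (P.obj n) (Q.obj n),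
    fun n => LinearMap.snd R (P.obj n) (Q.obj n), ?_, ?_, fun n => ?_, fun n => ?_,
    fun n => LinearMap.inl_injective, fun n => LinearMap.snd_surjective,
    fun n => (LinearMap.range_inl R _ _).symm⟩
  · ext p
    change A (p, 0) = _
    simp [hA]
  · refine LinearMap.ext fun ⟨p, q⟩ => ?_
    change Q.aug q = g (A (p, q))
    rw [hA, map_add, hgf, hh, zero_add]
  · refine LinearMap.ext fun p => ?_
    change D n (p, 0) = (P.d n p, 0)
    simp [hD]
  · rfl

/-- A minimal horseshoe forces `K ∩ J·M ⊆ J·K`. -/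
lemma MinimalHorseshoe.inf_le (H : MinimalHorseshoe J f g) :
    LinearMap.range f ⊓ jSMul J (⊤ : Submodule R M) ≤ Submodule.map f (jSMul J ⊤) := by
  obtain ⟨P, L, Q, φ, ψ, hφ, -, -, -, hinj, hsurj, hex⟩ := H
  have := Q.proj 0
  rintro _ ⟨⟨x, rfl⟩, hx⟩
  obtain ⟨p, rfl⟩ := P.aug_surj x
  have hφp : L.aug (φ 0 p) = f (P.aug p) := LinearMap.congr_fun hφ p
  have hp : φ 0 p ∈ jSMul J (⊤ : Submodule R (L.obj 0)) := by
    refine mem_jSMul_top_of_map_mem L.aug L.minimal0 ?_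
    rwa [LinearMap.range_eq_top.2 L.aug_surj, hφp]
  obtain ⟨r, hr⟩ : ∃ r : L.obj 0 →ₗ[R] P.obj 0, r ∘ₗ φ 0 = LinearMap.id := by
    obtain ⟨σ, hσ⟩ := Module.projective_lifting_property (ψ 0) LinearMap.id (hsurj 0)
    have hσ' : ∀ q, ψ 0 (σ q) = q := LinearMap.congr_fun hσ
    have hmem : ∀ l : L.obj 0, ((LinearMap.id : L.obj 0 →ₗ[R] L.obj 0) - σ ∘ₗ ψ 0) l ∈ LinearMap.range (φ 0) := fun l => by
      rw [← hex 0, LinearMap.mem_ker]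
      simp [hσ']
    refine ⟨(LinearEquiv.ofInjective (φ 0) (hinj 0)).symm.toLinearMap ∘ₗ
      (LinearMap.id - σ ∘ₗ ψ 0).codRestrict _ hmem, LinearMap.ext fun y => ?_⟩
    have hy : ψ 0 (φ 0 y) = 0 := by
      rw [← LinearMap.mem_ker, hex 0]
      exact ⟨y, rfl⟩
    change (LinearEquiv.ofInjective (φ 0) (hinj 0)).symm _ = y
    rw [LinearEquiv.symm_apply_eq]
    ext
    simp [hy]
  have h := map_mem_jSMul_top r hp
  rw [← LinearMap.comp_apply, hr] at h
  exact ⟨P.aug p, map_mem_jSMul_top P.aug h, rfl⟩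

end Horseshoe

/-- Corollary B(1): for a short exact sequence of quasi-Koszul
modules over an augmented Noetherian semiperfect algebra, `J·K = K ∩ J·M` iff
the minimal Horseshoe Lemma holds. -/
theorem quasiKoszul_jsmul_iff_minimalHorseshoe
    {k : Type} [Field k] {R : Type} [Ring R] [Algebra k R] (ε : R →ₐ[k] k)
    [IsNoetherianRing R] (hsp : Semiperfect R) (J : Ideal R)
    (hJ : J = jacobsonRad R)
    {K M N : Type} [AddCommGroup K] [Module R K] [AddCommGroup M] [Module R M]
    [AddCommGroup N] [Module R N]
    [Module.Finite R K] [Module.Finite R M] [Module.Finite R N]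
    (f : K →ₗ[R] M) (g : M →ₗ[R] N)
    (hf : Function.Injective f) (hg : Function.Surjective g)
    (hfg : LinearMap.range f = LinearMap.ker g)
    (hK : IsQuasiKoszul J K) (hM : IsQuasiKoszul J M)
    (hN : IsQuasiKoszul J N) :
    Submodule.map f (jSMul J (⊤ : Submodule R K)) =
      LinearMap.range f ⊓ jSMul J (⊤ : Submodule R M) ↔
    MinimalHorseshoe J f g := by
  refine ⟨fun h => minimalHorseshoe_of_isQuasiKoszul hf hg hfg hK hN.choose h.ge,
    fun H => le_antisymm (le_inf LinearMap.map_le_range ?_) (H.inf_le)⟩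
  rintro _ ⟨x, hx, rfl⟩
  exact map_mem_jSMul_top f hx
end
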